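/- arXiv:2202.05059 — 3 statements merged into one kernel-verified Lean document; each statement's English description precedes it below -/
import Mathlib

section
/- Let M ≥ 2 and Kc ≥ 0 be integers, λ > 0, and y = (y₀, y₁, …, y_{Kc}) ∈ ℝ × ℂ^{Kc}. Consider the quadratic objective J(w,a) := ½(|y₀ − a|² + Σ_{k=1}^{Kc} |y_k − ŵ[k]/(ik)^M|²) + λ‖w‖_M over pairs (w,a) with w ∈ M(𝕋) of zero mean and a ∈ ℝ, with unique minimizer (w*, a*). For each integer P ≥ 1, let (w_P, a_P) be any minimizer of J over the grid-restricted class of pairs (w,a) with w = Σ_{p=0}^{P−1} c_p δ_{2πp/P}, c ∈ ℝ^P, Σ_p c_p = 0, and a ∈ ℝ. Then, as P → ∞: (i) w_P converges to w* in the weak* sense, i.e., ∫_𝕋 φ dw_P → ∫_𝕋 φ dw* for every continuous function φ : 𝕋 → ℝ, and a_P → a*; and (ii) consequently, (g_M ⊛ w_P)(x) + a_P → (g_M ⊛ w*)(x) + a* for every x ∈ 𝕋 (pointwise convergence of the reconstructed functions). -/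
open MeasureTheory Filter
open scoped ENNReal Real

noncomputable section

instance fact2pi : Fact (0 < 2 * Real.pi) := ⟨by positivity⟩

/-- The circle `𝕋 = ℝ/(2πℤ)`. -/
abbrev Circle2pi : Type := AddCircle (2 * Real.pi)

/-- Integral of a real function against a finite real signed (Radon) measure on `𝕋`. -/
noncomputable def sIntR (w : SignedMeasure Circle2pi) (f : Circle2pi → ℝ) : ℝ :=
  (∫ x, f x ∂w.toJordanDecomposition.posPart) - ∫ x, f x ∂w.toJordanDecomposition.negPart

/-- Integral of a complex function against a signed measure on `𝕋`. -/
noncomputable def sIntC (w : SignedMeasure Circle2pi) (f : Circle2pi → ℂ) : ℂ :=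
  (∫ x, f x ∂w.toJordanDecomposition.posPart) - ∫ x, f x ∂w.toJordanDecomposition.negPart

/-- Total-variation norm `‖w‖_M` of a signed measure on `𝕋`. -/
noncomputable def tvNorm (w : SignedMeasure Circle2pi) : ℝ :=
  (w.totalVariation Set.univ).toReal

/-- The `k`-th Fourier coefficient `ŵ[k] = ∫_𝕋 e^{-ikx} dw(x)` of a signed measure. -/
noncomputable def fCoeff (w : SignedMeasure Circle2pi) (k : ℤ) : ℂ :=
  sIntC w fun x => fourier (-k) x

/-- The Dirac measure `δ_x` as a signed measure. -/
noncomputable def diracSM (x : Circle2pi) : SignedMeasure Circle2pi :=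
  (MeasureTheory.Measure.dirac x).toSignedMeasure

/-- The quadratic objective
`J(w,a) = ½(|y₀-a|² + Σ_{k=1}^{Kc} |y_k - ŵ[k]/(ik)^M|²) + λ‖w‖_M`. -/
noncomputable def quadJ (M Kc : ℕ) (y0 : ℝ) (yr : Fin Kc → ℂ) (lam : ℝ)
    (w : SignedMeasure Circle2pi) (a : ℝ) : ℝ :=
  (1 / 2) * ((y0 - a) ^ 2 +
      ∑ k : Fin Kc,
        ‖yr k - fCoeff w ((k.1 : ℤ) + 1) / (Complex.I * ((k.1 + 1 : ℕ) : ℂ)) ^ M‖ ^ 2)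
    + lam * tvNorm w

/-- The periodic Green's function `g_M(x) = Σ_{k≠0} e^{ikx}/(ik)^M` of `D^M` (complex form). -/
noncomputable def greenC (M : ℕ) (x : Circle2pi) : ℂ :=
  ∑' k : ℤ, if k = 0 then 0 else fourier k x / (Complex.I * (k : ℂ)) ^ M

/-- The (real-valued) periodic Green's function of `D^M`. -/
noncomputable def greenR (M : ℕ) (x : Circle2pi) : ℝ := (greenC M x).re

/-- The convolution `(g_M ⊛ w)(x) = ∫_𝕋 g_M(x-t) dw(t)`. -/
noncomputable def greenConv (M : ℕ) (w : SignedMeasure Circle2pi) (x : Circle2pi) : ℝ :=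
  sIntR w fun t => greenR M (x - t)

/-- The grid point `2πp/P ∈ 𝕋`. -/
noncomputable def gridPt (P : ℕ) (p : Fin P) : Circle2pi :=
  ((2 * Real.pi * (p.1 : ℝ) / (P : ℝ) : ℝ) : Circle2pi)

/-- The grid-restricted class: `w = Σ_{p=0}^{P-1} c_p δ_{2πp/P}` with `Σ_p c_p = 0`. -/
def IsGridMeasure (P : ℕ) (w : SignedMeasure Circle2pi) : Prop :=
  ∃ c : Fin P → ℝ, (∑ p, c p) = 0 ∧ w = ∑ p, c p • diracSM (gridPt P p)

end

noncomputable abbrev jp (w : SignedMeasure Circle2pi) : Measure Circle2pi := w.toJordanDecomposition.posPart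
noncomputable abbrev jn (w : SignedMeasure Circle2pi) : Measure Circle2pi := w.toJordanDecomposition.negPart

lemma jordan_eq (w : SignedMeasure Circle2pi) :
    w = (jp w).toSignedMeasure - (jn w).toSignedMeasure :=
  (SignedMeasure.toSignedMeasure_toJordanDecomposition w).symm

lemma jordan_rep (w : SignedMeasure Circle2pi) (μ ν : Measure Circle2pi) [IsFiniteMeasure μ]
    [IsFiniteMeasure ν] (h : w = μ.toSignedMeasure - ν.toSignedMeasure) :
    jp w + ν = μ + jn w := by
  have h1 := jordan_eq w
  rw [← Measure.toSignedMeasure_eq_toSignedMeasure_iff, Measure.toSignedMeasure_add,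
    Measure.toSignedMeasure_add]
  have h2 := h.symm.trans h1
  rw [sub_eq_sub_iff_add_eq_add] at h2
  exact h2.symm

lemma tv_eq (w : SignedMeasure Circle2pi) :
    tvNorm w = (jp w).real Set.univ + (jn w).real Set.univ := by
  unfold tvNorm SignedMeasure.totalVariation
  rw [Measure.add_apply, ENNReal.toReal_add (measure_ne_top _ _) (measure_ne_top _ _)]
  rfl

lemma tv_le (w : SignedMeasure Circle2pi) (μ ν : Measure Circle2pi) [IsFiniteMeasure μ]
    [IsFiniteMeasure ν] (h : w = μ.toSignedMeasure - ν.toSignedMeasure) :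
    tvNorm w ≤ μ.real Set.univ + ν.real Set.univ := by
  have h1 := jordan_rep w μ ν h
  obtain ⟨S, hS, hp, hn⟩ := w.toJordanDecomposition.mutuallySingular
  change jp w S = 0 at hp
  change jn w Sᶜ = 0 at hn
  rw [tv_eq]
  have e1 : (jp w).real Set.univ = (jp w).real Sᶜ := by
    rw [← measureReal_add_measureReal_compl hS]
    simp [measureReal_def, hp]
  have e2 : (jn w).real Set.univ = (jn w).real S := by
    rw [← measureReal_add_measureReal_compl hS]
    simp [measureReal_def, hn]
  have a1 := congrArg (fun m : Measure Circle2pi => m.real S) h1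
  have a2 := congrArg (fun m : Measure Circle2pi => m.real Sᶜ) h1
  rw [measureReal_add_apply, measureReal_add_apply] at a1 a2
  have z1 : (jp w).real S = 0 := by simp [measureReal_def, hp]
  have z2 : (jn w).real Sᶜ = 0 := by simp [measureReal_def, hn]
  have b1 : μ.real Sᶜ ≤ μ.real Set.univ := measureReal_mono (Set.subset_univ _)
  have b2 : ν.real S ≤ ν.real Set.univ := measureReal_mono (Set.subset_univ _)
  have b3 : 0 ≤ μ.real S := measureReal_nonneg
  have b4 : 0 ≤ ν.real Sᶜ := measureReal_nonneg
  linarith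

lemma integ {E : Type*} [NormedAddCommGroup E] (μ : Measure Circle2pi)
    [IsFiniteMeasure μ] {f : Circle2pi → E} (hf : Continuous f) : Integrable f μ :=
  hf.integrable_of_hasCompactSupport (HasCompactSupport.of_compactSpace f)

lemma sIntC_rep (w : SignedMeasure Circle2pi) (μ ν : Measure Circle2pi) [IsFiniteMeasure μ]
    [IsFiniteMeasure ν] (h : w = μ.toSignedMeasure - ν.toSignedMeasure)
    (f : Circle2pi → ℂ) (hf : Continuous f) :
    sIntC w f = (∫ x, f x ∂μ) - ∫ x, f x ∂ν := by
  have h1 := congrArg (fun m => ∫ x, f x ∂m) (jordan_rep w μ ν h)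
  rw [integral_add_measure (integ _ hf) (integ _ hf),
    integral_add_measure (integ _ hf) (integ _ hf)] at h1
  unfold sIntC
  rw [sub_eq_sub_iff_add_eq_add]
  exact h1

lemma ofReal_sIntR (w : SignedMeasure Circle2pi) (f : Circle2pi → ℝ) :
    ((sIntR w f : ℝ) : ℂ) = sIntC w (fun x => (f x : ℂ)) := by
  unfold sIntR sIntC
  push_cast
  rw [← integral_complex_ofReal, ← integral_complex_ofReal]

lemma univ_eq (w : SignedMeasure Circle2pi) :
    w Set.univ = (jp w).real Set.univ - (jn w).real Set.univ := by
  conv_lhs => rw [jordan_eq w]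
  simp [Measure.toSignedMeasure_apply]

lemma sIntC_add (w : SignedMeasure Circle2pi) (f g : Circle2pi → ℂ) (hf : Continuous f)
    (hg : Continuous g) : sIntC w (fun x => f x + g x) = sIntC w f + sIntC w g := by
  unfold sIntC
  rw [integral_add (integ _ hf) (integ _ hg), integral_add (integ _ hf) (integ _ hg)]
  ring

lemma sIntC_smul (w : SignedMeasure Circle2pi) (c : ℂ) (f : Circle2pi → ℂ)  :
    sIntC w (fun x => c * f x) = c * sIntC w f := by
  unfold sIntC
  rw [integral_const_mul, integral_const_mul]
  ring

lemma sIntC_sum {ι : Type*} (s : Finset ι) (w : SignedMeasure Circle2pi)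
    (f : ι → Circle2pi → ℂ) (hf : ∀ i, Continuous (f i)) :
    sIntC w (fun x => ∑ i ∈ s, f i x) = ∑ i ∈ s, sIntC w (f i) := by
  unfold sIntC
  rw [integral_finsetSum _ (fun i _ => integ _ (hf i)),
    integral_finsetSum _ (fun i _ => integ _ (hf i)), Finset.sum_sub_distrib]

lemma sIntC_bound (w : SignedMeasure Circle2pi) (f : Circle2pi → ℂ) :
    ‖sIntC w f‖ ≤ (∫ x, ‖f x‖ ∂(jp w)) + ∫ x, ‖f x‖ ∂(jn w) :=
  (norm_sub_le _ _).trans (add_le_add (norm_integral_le_integral_norm _)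
    (norm_integral_le_integral_norm _))

lemma fCoeff_zero (w : SignedMeasure Circle2pi) (h : w Set.univ = 0) : fCoeff w 0 = 0 := by
  rw [univ_eq] at h
  unfold fCoeff sIntC
  simp only [neg_zero, fourier_zero, integral_const]
  rw [← sub_smul]
  rw [show w.toJordanDecomposition.posPart.real Set.univ -
    w.toJordanDecomposition.negPart.real Set.univ = 0 from h]
  simp

lemma fCoeff_neg (w : SignedMeasure Circle2pi) (k : ℤ) :
    fCoeff w (-k) = (starRingEnd ℂ) (fCoeff w k) := by
  unfold fCoeff sIntC
  rw [map_sub, ← integral_conj, ← integral_conj]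
  simp only [← fourier_neg]

lemma tendsto_green (M : ℕ) (hM : 2 ≤ M) : Continuous (greenR M) := by
  unfold greenR greenC
  refine Complex.continuous_re.comp ?_
  have hs : Summable (fun k : ℤ => 1 / |(k:ℝ)| ^ M) := by
    have := (Real.summable_one_div_int_pow (p := M)).2 (by omega)
    refine this.abs.congr fun k => ?_
    simp [abs_pow]
  refine continuous_tsum (u := fun k : ℤ => 1 / |(k:ℝ)| ^ M) ?_ hs ?_
  · intro k
    split_ifs
    · exact continuous_const
    · exact (map_continuous _).div_const _
  · intro k x
    split_ifs
    · simp
    · rw [norm_div, norm_pow, norm_mul, Complex.norm_I, one_mul, Complex.norm_intCast]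
      gcongr
      exact (ContinuousMap.norm_coe_le_norm _ x).trans (fourier_norm k).le


noncomputable def etaF {Kc : ℕ} (α : Fin Kc → ℂ) (x : Circle2pi) : ℝ :=
  ∑ k : Fin Kc, (α k * fourier (-((k.1 : ℤ) + 1)) x).re

lemma etaF_cont {Kc : ℕ} (α : Fin Kc → ℂ) : Continuous (etaF α) := by
  unfold etaF
  refine continuous_finsetSum _ fun k _ => ?_
  exact Complex.continuous_re.comp (continuous_const.mul (map_continuous _))

noncomputable def ee (x : Circle2pi) : ℂ := (AddCircle.toCircle x : ℂ)

lemma ee_ne (x : Circle2pi) : ee x ≠ 0 := Circle.coe_ne_zero _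

lemma ee_inj : Function.Injective ee := by
  intro x y h
  exact AddCircle.injective_toCircle (fact2pi.out.ne') (Subtype.ext h)

lemma fourier_ee (n : ℤ) (x : Circle2pi) : fourier n x = ee x ^ n := by
  rw [fourier_apply, AddCircle.toCircle_zsmul, Circle.coe_zpow]; rfl

noncomputable def etaQ {Kc : ℕ} (α : Fin Kc → ℂ) : Polynomial ℂ :=
  ∑ k : Fin Kc, (Polynomial.C (-(((k.1 : ℂ) + 1) * Complex.I * α k)) *
      Polynomial.X ^ (Kc - (k.1 + 1)) +
    Polynomial.C (((k.1 : ℂ) + 1) * Complex.I * (starRingEnd ℂ) (α k)) *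
      Polynomial.X ^ (Kc + (k.1 + 1)))

lemma etaQ_deg {Kc : ℕ} (α : Fin Kc → ℂ) : (etaQ α).natDegree ≤ 2 * Kc := by
  unfold etaQ
  refine Polynomial.natDegree_sum_le_of_forall_le _ _ fun k _ => ?_
  have := k.2
  refine (Polynomial.natDegree_add_le _ _).trans (max_le ?_ ?_)
  · exact (Polynomial.natDegree_C_mul_X_pow_le _ _).trans (by omega)
  · exact (Polynomial.natDegree_C_mul_X_pow_le _ _).trans (by omega)

lemma etaF_deriv {Kc : ℕ} (α : Fin Kc → ℂ) (t : ℝ) :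
    ∃ d : ℝ, HasDerivAt (fun t : ℝ => etaF α (t : Circle2pi)) d t ∧
      (d : ℂ) * 2 * ee t ^ Kc = (etaQ α).eval (ee t) := by
  have hk : ∀ k : Fin Kc, HasDerivAt
      (fun t : ℝ => (α k * fourier (-((k.1 : ℤ) + 1)) (t : Circle2pi)).re)
      ((α k * (-((k.1 : ℂ) + 1) * Complex.I * fourier (-((k.1 : ℤ) + 1)) (t : Circle2pi))).re) t := by
    intro k
    have h := (hasDerivAt_fourier (2 * Real.pi) (-((k.1 : ℤ) + 1)) t).const_mul (α k)
    have h2 := (Complex.reCLM.hasFDerivAt.comp_hasDerivAt t h)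
    convert! h2 using 1
    simp only [Complex.reCLM_apply]
    congr 2
    have : (Real.pi : ℂ) ≠ 0 := by exact_mod_cast Real.pi_ne_zero
    push_cast
    field_simp
  refine ⟨_, HasDerivAt.fun_sum fun k _ => hk k, ?_⟩
  unfold etaQ
  rw [Polynomial.eval_finsetSum]
  push_cast
  rw [Finset.sum_mul, Finset.sum_mul]
  refine Finset.sum_congr rfl fun k _ => ?_
  have hz := ee_ne (t : Circle2pi)
  have key : ∀ z : ℂ, ((z.re : ℝ) : ℂ) * 2 = z + (starRingEnd ℂ) z := by
    intro z; rw [Complex.add_conj]; push_cast; ring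
  rw [key]
  rw [Polynomial.eval_add, Polynomial.eval_mul, Polynomial.eval_mul, Polynomial.eval_C,
    Polynomial.eval_C, Polynomial.eval_pow, Polynomial.eval_pow, Polynomial.eval_X]
  simp only [map_mul, map_neg, map_add, map_natCast, map_one, Complex.conj_I, ← fourier_neg,
    neg_neg]
  rw [fourier_ee, fourier_ee]
  have e1 : ee (t : Circle2pi) ^ (-((k.1 : ℤ) + 1)) * ee t ^ Kc = ee t ^ (Kc - (k.1 + 1)) := by
    rw [← zpow_natCast, ← zpow_natCast, ← zpow_add₀ hz]
    congr 1
    have := k.2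
    omega
  have e2 : ee (t : Circle2pi) ^ (((k.1 : ℤ) + 1)) * ee t ^ Kc = ee t ^ (Kc + (k.1 + 1)) := by
    rw [← zpow_natCast, ← zpow_natCast, ← zpow_add₀ hz]
    congr 1
    push_cast; ring
  rw [← e1, ← e2]
  ring

lemma eta_extr {Kc : ℕ} (α : Fin Kc → ℂ) :
    (∀ x y, etaF α x = etaF α y) ∨ ∃ E : Finset Circle2pi, E.card ≤ 2 * Kc ∧
      ∀ x, ((∀ y, etaF α y ≤ etaF α x) ∨ (∀ y, etaF α x ≤ etaF α y)) → x ∈ E := by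
  classical
  by_cases hQ : etaQ α = 0
  · left
    have hd : ∀ t : ℝ, HasDerivAt (fun t : ℝ => etaF α (t : Circle2pi)) 0 t := by
      intro t
      obtain ⟨d, h1, h2⟩ := etaF_deriv α t
      rw [hQ] at h2
      have h3 := pow_ne_zero Kc (ee_ne (t : Circle2pi))
      have : d = 0 := by
        simp [h3] at h2; exact h2
      rwa [this] at h1
    intro x y
    induction x using QuotientAddGroup.induction_on with | H x =>
    induction y using QuotientAddGroup.induction_on with | H y =>
    exact is_const_of_deriv_eq_zero (f := fun t : ℝ => etaF α (t : Circle2pi))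
      (fun t => (hd t).differentiableAt) (fun t => (hd t).deriv) x y
  · right
    refine ⟨(etaQ α).roots.toFinset.preimage ee ee_inj.injOn, ?_, ?_⟩
    · refine (Finset.card_le_card_of_injOn ee ?_ ee_inj.injOn).trans
        ((Multiset.toFinset_card_le _).trans ((Polynomial.card_roots' _).trans (etaQ_deg α)))
      intro x hx
      simpa using hx
    · intro x hx
      rw [Finset.mem_preimage, Multiset.mem_toFinset, Polynomial.mem_roots hQ, Polynomial.IsRoot]
      induction x using QuotientAddGroup.induction_on with | H t =>
      obtain ⟨d, h1, h2⟩ := etaF_deriv α t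
      change Polynomial.eval (ee (t : Circle2pi)) _ = 0
      rw [← h2]
      have : d = 0 := by
        rcases hx with hx | hx
        · exact IsLocalMax.hasDerivAt_eq_zero (Eventually.of_forall fun s => hx (s : Circle2pi)) h1
        · exact IsLocalMin.hasDerivAt_eq_zero (Eventually.of_forall fun s => hx (s : Circle2pi)) h1
      simp [this]

lemma interp (Kc : ℕ) (E : Finset Circle2pi) (hE : E.card ≤ 2 * Kc) (φ : Circle2pi → ℂ) :
    ∃ b : ℕ → ℂ, ∀ x ∈ E,
      ∑ j ∈ Finset.range (2 * Kc + 1), b j * fourier (-((Kc : ℤ) - j)) x = φ x := by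
  classical
  set p := Lagrange.interpolate E ee (fun x => φ x * ee x ^ Kc) with hp
  refine ⟨p.coeff, fun x hx => ?_⟩
  have h1 : p.eval (ee x) = φ x * ee x ^ Kc :=
    Lagrange.eval_interpolate_at_node _ ee_inj.injOn hx
  have h2 : p.natDegree < 2 * Kc + 1 := by
    have := Lagrange.degree_interpolate_le (fun x => φ x * ee x ^ Kc) (s := E) (v := ee) ee_inj.injOn
    have := Polynomial.natDegree_le_of_degree_le this
    rw [← hp] at this
    omega
  rw [Polynomial.eval_eq_sum_range' h2] at h1
  have hz := ee_ne x
  refine mul_right_cancel₀ (pow_ne_zero Kc hz) ?_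
  rw [← h1, Finset.sum_mul]
  refine Finset.sum_congr rfl fun j _ => ?_
  rw [fourier_ee, mul_assoc]
  congr 1
  rw [← zpow_natCast, ← zpow_natCast, ← zpow_add₀ hz]
  congr 1
  ring

lemma dom_bound (g h : Circle2pi → ℝ) (hg : Continuous g) (hh : Continuous h)
    (h0 : ∀ x, 0 ≤ h x) (hz : ∀ x, h x = 0 → g x ≤ 0) (ε : ℝ) (hε : 0 < ε) :
    ∃ C : ℝ, 0 ≤ C ∧ ∀ x, g x ≤ ε + C * h x := by
  have hK : IsCompact {x | ε ≤ g x} := (isClosed_le continuous_const hg).isCompact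
  rcases Set.eq_empty_or_nonempty {x | ε ≤ g x} with he | hne
  · refine ⟨0, le_rfl, fun x => ?_⟩
    have : x ∉ {x | ε ≤ g x} := by rw [he]; simp
    simp only [Set.mem_ofPred_eq, not_le] at this
    linarith
  · obtain ⟨a, ha, hmin⟩ := hK.exists_isMinOn hne hh.continuousOn
    obtain ⟨b, hb, hmax⟩ := hK.exists_isMaxOn hne hg.continuousOn
    have hpos : 0 < h a := by
      rcases (h0 a).lt_or_eq with h | h
      · exact h
      · have := hz a h.symm
        have h3 : ε ≤ g a := ha
        linarith
    have hb' : ε ≤ g b := hb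
    have hb0 : 0 ≤ g b := by linarith
    refine ⟨g b / h a, by positivity, fun x => ?_⟩
    by_cases hx : ε ≤ g x
    · have h1 : g x ≤ g b := hmax hx
      have h2 : h a ≤ h x := hmin hx
      have h3 : g b ≤ g b / h a * h x := by
        rw [div_mul_eq_mul_div, le_div_iff₀ hpos]
        gcongr
      linarith
    · have : 0 ≤ g b / h a * h x := mul_nonneg (by positivity) (h0 x)
      linarith

lemma conc (μ : ℕ → Measure Circle2pi) [∀ n, IsFiniteMeasure (μ n)] (C : ℝ)
    (hC : ∀ᶠ n in atTop, (μ n).real Set.univ ≤ C)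
    (g h : Circle2pi → ℝ) (hg : Continuous g) (hh : Continuous h) (g0 : ∀ x, 0 ≤ g x)
    (h0 : ∀ x, 0 ≤ h x) (hz : ∀ x, h x = 0 → g x ≤ 0)
    (hlim : Tendsto (fun n => ∫ x, h x ∂(μ n)) atTop (nhds 0)) :
    Tendsto (fun n => ∫ x, g x ∂(μ n)) atTop (nhds 0) := by
  rw [Metric.tendsto_atTop']
  intro ε hε
  have hC' : 0 < |C| + 1 := by positivity
  obtain ⟨D, hD, hb⟩ := dom_bound g h hg hh h0 hz (ε / 2 / (|C| + 1)) (by positivity)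
  have h1 : Tendsto (fun n => D * ∫ x, h x ∂(μ n)) atTop (nhds 0) := by
    simpa using hlim.const_mul D
  have h2 := (h1.eventually (gt_mem_nhds (show (0:ℝ) < ε / 2 by positivity))).and hC
  obtain ⟨N, hN⟩ := eventually_atTop.1 h2
  refine ⟨N, fun n hn => ?_⟩
  obtain ⟨h3, h4⟩ := hN n hn.le
  have h5 : ∫ x, g x ∂(μ n) ≤ ∫ x, (ε / 2 / (|C| + 1) + D * h x) ∂(μ n) :=
    integral_mono (integ _ hg) (integ _ (by fun_prop)) hb
  rw [integral_add (integ _ continuous_const) (integ _ (by fun_prop)), integral_const_mul,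
    integral_const, smul_eq_mul] at h5
  have h6 : (μ n).real Set.univ * (ε / 2 / (|C| + 1)) ≤ ε / 2 := by
    calc _ ≤ (|C| + 1) * (ε / 2 / (|C| + 1)) := by
          gcongr
          linarith [le_abs_self C]
      _ = ε / 2 := by field_simp
  rw [Real.dist_eq, sub_zero, abs_of_nonneg (integral_nonneg g0)]
  linarith

noncomputable def tt (x : Circle2pi) : ℝ :=
  ((AddCircle.measurableEquivIco (2 * Real.pi) 0 x : Set.Ico (0:ℝ) (0 + 2 * Real.pi)) : ℝ)

lemma tt_meas : Measurable tt :=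
  measurable_subtype_coe.comp (AddCircle.measurableEquivIco (2 * Real.pi) 0).measurable

lemma tt_coe (x : Circle2pi) : ((tt x : ℝ) : Circle2pi) = x :=
  (AddCircle.equivIco (2 * Real.pi) 0).symm_apply_apply x

lemma tt_nonneg (x : Circle2pi) : 0 ≤ tt x :=
  (AddCircle.measurableEquivIco (2 * Real.pi) 0 x).2.1

lemma tt_lt (x : Circle2pi) : tt x < 2 * Real.pi := by
  have := (AddCircle.measurableEquivIco (2 * Real.pi) 0 x).2.2
  exact lt_of_lt_of_eq this (zero_add _)

noncomputable def fl (P : ℕ) (x : Circle2pi) : ℕ := ⌊tt x / (2 * Real.pi) * P⌋₊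

lemma fl_lt (P : ℕ) (hP : 1 ≤ P) (x : Circle2pi) : fl P x < P := by
  unfold fl
  have hP' : (0:ℝ) < P := by exact_mod_cast hP
  rw [Nat.floor_lt (by have := tt_nonneg x; positivity)]
  have : tt x / (2 * Real.pi) < 1 := by
    rw [div_lt_one (by positivity)]; exact tt_lt x
  nlinarith

lemma fl_meas (P : ℕ) : Measurable (fl P) :=
  Nat.measurable_floor.comp ((tt_meas.div_const _).mul_const _)

noncomputable def rho (P : ℕ) (x : Circle2pi) : Circle2pi :=
  ((2 * Real.pi * (fl P x : ℝ) / (P : ℝ) : ℝ) : Circle2pi)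

lemma rho_meas (P : ℕ) : Measurable (rho P) := by
  have : Measurable (fun n : ℕ => ((2 * Real.pi * (n : ℝ) / (P : ℝ) : ℝ) : Circle2pi)) :=
    measurable_of_countable _
  exact this.comp (fl_meas P)

lemma rho_tendsto (x : Circle2pi) : Tendsto (fun P => rho P x) atTop (nhds x) := by
  have h1 := (tendsto_nat_floor_mul_div_atTop (R := ℝ)
    (a := tt x / (2 * Real.pi)) (by have := tt_nonneg x; positivity)).comp
    (tendsto_natCast_atTop_atTop (R := ℝ))
  have h2 := (h1.const_mul (2 * Real.pi))
  have h3 : 2 * Real.pi * (tt x / (2 * Real.pi)) = tt x := by field_simp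
  rw [h3] at h2
  have h4 := ((AddCircle.continuous_mk' (2 * Real.pi)).tendsto (tt x)).comp h2
  have h5 : (QuotientAddGroup.mk' (AddSubgroup.zmultiples (2 * Real.pi))) (tt x) = x := tt_coe x
  rw [h5] at h4
  refine h4.congr fun P => ?_
  simp only [Function.comp, rho, fl, mul_div_assoc]
  rfl

lemma rho_int (μ : Measure Circle2pi) [IsFiniteMeasure μ] (f : Circle2pi → ℂ)
    (hf : Continuous f) :
    Tendsto (fun P => ∫ x, f x ∂(μ.map (rho P))) atTop (nhds (∫ x, f x ∂μ)) := by
  have h : ∀ P, ∫ x, f x ∂(μ.map (rho P)) = ∫ x, f (rho P x) ∂μ := fun P =>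
    integral_map (rho_meas P).aemeasurable hf.aestronglyMeasurable
  simp only [h]
  obtain ⟨C, hC⟩ := (isCompact_range hf).isBounded.exists_norm_le
  refine tendsto_integral_of_dominated_convergence (fun _ => C)
    (fun P => (hf.measurable.comp (rho_meas P)).aestronglyMeasurable)
    (integrable_const C) (fun P => Eventually.of_forall fun x => hC _ ⟨_, rfl⟩)
    (Eventually.of_forall fun x => (hf.tendsto x).comp (rho_tendsto x))

lemma rho_map (P : ℕ) (hP : 1 ≤ P) (μ : Measure Circle2pi) [IsFiniteMeasure μ] :
    (μ.map (rho P)).toSignedMeasure =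
      ∑ p : Fin P, μ.real (fl P ⁻¹' {p.1}) • diracSM (gridPt P p) := by
  classical
  ext s hs
  have hsum : ∀ (F : Fin P → SignedMeasure Circle2pi), (∑ p, F p) s = ∑ p, F p s := by
    intro F
    rw [FunLike.coe_sum, Finset.sum_apply]
  rw [hsum, Measure.toSignedMeasure_apply_measurable hs]
  have hterm : ∀ p : Fin P, (μ.real (fl P ⁻¹' {p.1}) • diracSM (gridPt P p)) s =
      if ((2 * Real.pi * (p.1 : ℝ) / (P : ℝ) : ℝ) : Circle2pi) ∈ s
        then μ.real (fl P ⁻¹' {p.1}) else 0 := by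
    intro p
    rw [smul_apply, diracSM, Measure.toSignedMeasure_apply_measurable hs,
      measureReal_def (Measure.dirac _), Measure.dirac_apply' _ hs, Set.indicator_apply]
    change _ • ENNReal.toReal (if ((2 * Real.pi * (p.1 : ℝ) / (P : ℝ) : ℝ) : Circle2pi) ∈ s
      then 1 else 0) = _
    split_ifs <;> simp
  rw [Finset.sum_congr rfl fun p _ => hterm p,
    Fin.sum_univ_eq_sum_range (fun n : ℕ =>
      if ((2 * Real.pi * (n : ℝ) / (P : ℝ) : ℝ) : Circle2pi) ∈ s
        then μ.real (fl P ⁻¹' {n}) else 0), ← Finset.sum_filter,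
    sum_measureReal_preimage_singleton _ (fun y _ => fl_meas P (measurableSet_singleton y)),
    measureReal_def, measureReal_def, Measure.map_apply (rho_meas P) hs]
  congr 2
  ext x
  simp [fl_lt P hP x, rho]

noncomputable def vgrid (P : ℕ) (w : SignedMeasure Circle2pi) : SignedMeasure Circle2pi :=
  ((jp w).map (rho P)).toSignedMeasure - ((jn w).map (rho P)).toSignedMeasure

lemma map_univ_real (P : ℕ) (μ : Measure Circle2pi) :
    (μ.map (rho P)).real Set.univ = μ.real Set.univ := by
  simp [measureReal_def, Measure.map_apply (rho_meas P) MeasurableSet.univ]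

lemma sum_fl (P : ℕ) (hP : 1 ≤ P) (μ : Measure Circle2pi) [IsFiniteMeasure μ] :
    ∑ p : Fin P, μ.real (fl P ⁻¹' {p.1}) = μ.real Set.univ := by
  rw [Fin.sum_univ_eq_sum_range (fun n => μ.real (fl P ⁻¹' {n})),
    sum_measureReal_preimage_singleton _ (fun y _ => fl_meas P (measurableSet_singleton y))]
  congr 1
  ext x
  simp [fl_lt P hP x]

lemma vgrid_grid (P : ℕ) (hP : 1 ≤ P) (w : SignedMeasure Circle2pi) (hw : w Set.univ = 0) :
    IsGridMeasure P (vgrid P w) := by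
  refine ⟨fun p => (jp w).real (fl P ⁻¹' {p.1}) - (jn w).real (fl P ⁻¹' {p.1}), ?_, ?_⟩
  · rw [Finset.sum_sub_distrib, sum_fl P hP, sum_fl P hP, ← univ_eq, hw]
  · unfold vgrid
    rw [rho_map P hP, rho_map P hP, ← Finset.sum_sub_distrib]
    refine Finset.sum_congr rfl fun p _ => ?_
    ext s hs
    simp [sub_mul]

lemma vgrid_tv (P : ℕ) (w : SignedMeasure Circle2pi) : tvNorm (vgrid P w) ≤ tvNorm w := by
  refine (tv_le _ _ _ rfl).trans ?_
  rw [map_univ_real, map_univ_real, tv_eq]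

lemma vgrid_tendsto (w : SignedMeasure Circle2pi) (f : Circle2pi → ℂ) (hf : Continuous f) :
    Tendsto (fun P => sIntC (vgrid P w) f) atTop (nhds (sIntC w f)) := by
  have : ∀ P, sIntC (vgrid P w) f = _ := fun P => sIntC_rep _ _ _ rfl f hf
  simp only [this]
  exact (rho_int _ f hf).sub (rho_int _ f hf)

lemma grid_zero (P : ℕ) (w : SignedMeasure Circle2pi) (h : IsGridMeasure P w) :
    w Set.univ = 0 := by
  obtain ⟨c, hc, rfl⟩ := h
  rw [FunLike.coe_sum, Finset.sum_apply]
  refine (Finset.sum_congr rfl fun p _ => ?_).trans hc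
  simp [diracSM, Measure.toSignedMeasure_apply]

lemma sIntR_re (w : SignedMeasure Circle2pi) (f : Circle2pi → ℂ) (hf : Continuous f) :
    sIntR w (fun x => (f x).re) = (sIntC w f).re := by
  unfold sIntR sIntC
  rw [Complex.sub_re]
  congr 1
  · exact integral_re (𝕜 := ℂ) (integ _ hf)
  · exact integral_re (𝕜 := ℂ) (integ _ hf)

lemma sIntR_rep (w : SignedMeasure Circle2pi) (μ ν : Measure Circle2pi) [IsFiniteMeasure μ]
    [IsFiniteMeasure ν] (h : w = μ.toSignedMeasure - ν.toSignedMeasure)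
    (f : Circle2pi → ℝ) (hf : Continuous f) :
    sIntR w f = (∫ x, f x ∂μ) - ∫ x, f x ∂ν := by
  have h1 := congrArg (fun m => ∫ x, f x ∂m) (jordan_rep w μ ν h)
  rw [integral_add_measure (integ _ hf) (integ _ hf),
    integral_add_measure (integ _ hf) (integ _ hf)] at h1
  unfold sIntR
  rw [sub_eq_sub_iff_add_eq_add]
  exact h1

lemma sIntR_eta {Kc : ℕ} (α : Fin Kc → ℂ) (w : SignedMeasure Circle2pi) :
    sIntR w (etaF α) = ∑ k : Fin Kc, (α k * fCoeff w ((k.1 : ℤ) + 1)).re := by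
  have h1 : etaF α = fun x => (∑ k : Fin Kc, α k * fourier (-((k.1 : ℤ) + 1)) x).re := by
    funext x
    rw [Complex.re_sum]; rfl
  have hc : ∀ k : Fin Kc, Continuous
      (fun x : Circle2pi => α k * fourier (-((k.1 : ℤ) + 1)) x) := fun k =>
    continuous_const.mul (map_continuous _)
  rw [h1, sIntR_re _ _ (continuous_finsetSum _ fun k _ => hc k), sIntC_sum _ _ _ hc,
    Complex.re_sum]
  refine Finset.sum_congr rfl fun k _ => ?_
  rw [sIntC_smul]
  rfl

noncomputable def FF (M : ℕ) (w : SignedMeasure Circle2pi) (k : ℕ) : ℂ :=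
  fCoeff w ((k : ℤ) + 1) / (Complex.I * ((k + 1 : ℕ) : ℂ)) ^ M

lemma den_ne (M k : ℕ) : (Complex.I * ((k + 1 : ℕ) : ℂ)) ^ M ≠ 0 :=
  pow_ne_zero _ (mul_ne_zero Complex.I_ne_zero (by exact_mod_cast Nat.succ_ne_zero k))

noncomputable def alf (M Kc : ℕ) (yr : Fin Kc → ℂ) (w : SignedMeasure Circle2pi)
    (k : Fin Kc) : ℂ :=
  (starRingEnd ℂ) (yr k - FF M w k.1) / (Complex.I * ((k.1 + 1 : ℕ) : ℂ)) ^ M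

lemma J_expand (M Kc : ℕ) (y0 : ℝ) (yr : Fin Kc → ℂ) (lam : ℝ)
    (ws w : SignedMeasure Circle2pi) (a : ℝ) :
    quadJ M Kc y0 yr lam w a = quadJ M Kc y0 yr lam ws y0 + (1 / 2) * (y0 - a) ^ 2
      - (sIntR w (etaF (alf M Kc yr ws)) - sIntR ws (etaF (alf M Kc yr ws)))
      + (1 / 2) * ∑ k : Fin Kc, ‖FF M w k.1 - FF M ws k.1‖ ^ 2
      + lam * (tvNorm w - tvNorm ws) := by
  have key : ∀ k : Fin Kc, ‖yr k - FF M w k.1‖ ^ 2 = ‖yr k - FF M ws k.1‖ ^ 2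
      - 2 * ((alf M Kc yr ws k * fCoeff w ((k.1 : ℤ) + 1)).re
        - (alf M Kc yr ws k * fCoeff ws ((k.1 : ℤ) + 1)).re)
      + ‖FF M w k.1 - FF M ws k.1‖ ^ 2 := by
    intro k
    have e : ∀ v : SignedMeasure Circle2pi, alf M Kc yr ws k * fCoeff v ((k.1 : ℤ) + 1) =
        (starRingEnd ℂ) (yr k - FF M ws k.1) * FF M v k.1 := by
      intro v; unfold alf FF; ring
    rw [e, e]
    generalize FF M w k.1 = p
    generalize FF M ws k.1 = q
    rw [← Complex.normSq_eq_norm_sq, ← Complex.normSq_eq_norm_sq, ← Complex.normSq_eq_norm_sq]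
    simp only [Complex.normSq_apply, Complex.sub_re, Complex.sub_im, Complex.mul_re,
      Complex.conj_re, Complex.conj_im]
    ring
  rw [sIntR_eta, sIntR_eta]
  unfold quadJ
  change (1 / 2) * ((y0 - a) ^ 2 + ∑ k : Fin Kc, ‖yr k - FF M w k.1‖ ^ 2) + lam * tvNorm w =
    (1 / 2) * ((y0 - y0) ^ 2 + ∑ k : Fin Kc, ‖yr k - FF M ws k.1‖ ^ 2) + lam * tvNorm ws + _
      - _ + _ + _
  rw [Finset.sum_congr rfl fun k _ => key k, Finset.sum_add_distrib, Finset.sum_sub_distrib,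
    ← Finset.mul_sum, Finset.sum_sub_distrib]
  ring

lemma small_t (a b : ℝ) (h : ∀ t : NNReal, 0 < t → t ≤ 1 → 0 ≤ (t:ℝ) * a + (t:ℝ) ^ 2 * b) :
    0 ≤ a := by
  by_contra! ha
  have hb : 0 < |b| + 1 + |a| := by positivity
  set t : ℝ := -a / (|b| + 1 + |a|) with ht
  have t0 : 0 < t := div_pos (by linarith) hb
  have t1 : t ≤ 1 := by
    rw [ht, div_le_one hb]; linarith [neg_le_abs a, abs_nonneg b]
  have := h ⟨t, t0.le⟩ t0 t1
  have h2 : 0 ≤ t * (a + t * b) := by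
    have e : t * (a + t * b) = t * a + t ^ 2 * b := by ring
    rw [e]; exact this
  have h3 : 0 ≤ a + t * b := by
    by_contra! hc
    nlinarith
  have h4 : t * (|b| + 1 + |a|) = -a := by rw [ht]; field_simp
  nlinarith [le_abs_self b, abs_nonneg a]

section opt
variable (M Kc : ℕ) (y0 : ℝ) (yr : Fin Kc → ℂ) (lam : ℝ) (ws : SignedMeasure Circle2pi)

lemma opt_osc (hzm : ws Set.univ = 0) (hlam : 0 < lam)
    (hstar : ∀ (w : SignedMeasure Circle2pi) (a : ℝ), w Set.univ = 0 →
      quadJ M Kc y0 yr lam ws y0 ≤ quadJ M Kc y0 yr lam w a) (x y : Circle2pi) :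
    etaF (alf M Kc yr ws) x - etaF (alf M Kc yr ws) y ≤ 2 * lam := by
  set η := etaF (alf M Kc yr ws) with hη
  have hηc : Continuous η := etaF_cont _
  rw [← sub_nonneg]
  refine small_t _ ((1 / 2) * ∑ k : Fin Kc, ‖(fourier (-((k.1 : ℤ) + 1)) x -
    fourier (-((k.1 : ℤ) + 1)) y) / (Complex.I * ((k.1 + 1 : ℕ) : ℂ)) ^ M‖ ^ 2) fun t t0 t1 => ?_
  set μ : Measure Circle2pi := jp ws + t • Measure.dirac x with hμ
  set ν : Measure Circle2pi := jn ws + t • Measure.dirac y with hν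
  set w : SignedMeasure Circle2pi := μ.toSignedMeasure - ν.toSignedMeasure with hw
  have hμu : μ.real Set.univ = (jp ws).real Set.univ + t := by
    rw [hμ, measureReal_add_apply]
    simp [measureReal_def]
  have hνu : ν.real Set.univ = (jn ws).real Set.univ + t := by
    rw [hν, measureReal_add_apply]
    simp [measureReal_def]
  have hw0 : w Set.univ = 0 := by
    have : w Set.univ = μ.real Set.univ - ν.real Set.univ := by
      simp [hw, Measure.toSignedMeasure_apply]
    rw [univ_eq] at hzm
    rw [this, hμu, hνu]
    linarith
  have htv : tvNorm w ≤ tvNorm ws + 2 * t := by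
    have := tv_le w μ ν hw
    rw [hμu, hνu] at this
    rw [tv_eq ws]
    linarith
  have hL : sIntR w η = sIntR ws η + t * (η x - η y) := by
    rw [sIntR_rep w μ ν hw η hηc, hμ, hν, integral_add_measure (integ _ hηc) (integ _ hηc),
      integral_add_measure (integ _ hηc) (integ _ hηc), integral_smul_nnreal_measure,
      integral_smul_nnreal_measure, integral_dirac, integral_dirac]
    unfold sIntR
    simp only [NNReal.smul_def, smul_eq_mul]
    ring
  have hF : ∀ n : ℤ, fCoeff w n = fCoeff ws n + t * (fourier (-n) x - fourier (-n) y) := by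
    intro n
    have hc : Continuous (fun x : Circle2pi => (fourier (-n) x : ℂ)) := map_continuous _
    unfold fCoeff
    rw [sIntC_rep w μ ν hw _ hc, hμ, hν, integral_add_measure (integ _ hc) (integ _ hc),
      integral_add_measure (integ _ hc) (integ _ hc), integral_smul_nnreal_measure,
      integral_smul_nnreal_measure, integral_dirac, integral_dirac]
    unfold sIntC
    simp only [NNReal.smul_def, Complex.real_smul]
    ring
  have hFF : ∀ k : ℕ, ‖FF M w k - FF M ws k‖ ^ 2 = (t:ℝ) ^ 2 * ‖(fourier (-((k : ℤ) + 1)) x -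
    fourier (-((k : ℤ) + 1)) y) / (Complex.I * ((k + 1 : ℕ) : ℂ)) ^ M‖ ^ 2 := by
    intro k
    unfold FF
    rw [hF, ← sub_div, add_sub_cancel_left, mul_div_assoc, norm_mul, mul_pow]
    congr 2
    simp
  have hJ := hstar w y0 hw0
  rw [J_expand M Kc y0 yr lam ws w y0, ← hη, hL, Finset.sum_congr rfl fun k _ => hFF k.1,
    ← Finset.mul_sum] at hJ
  have := mul_le_mul_of_nonneg_left htv hlam.le
  nlinarith

lemma opt_lower (hzm : ws Set.univ = 0)
    (hstar : ∀ (w : SignedMeasure Circle2pi) (a : ℝ), w Set.univ = 0 →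
      quadJ M Kc y0 yr lam ws y0 ≤ quadJ M Kc y0 yr lam w a) (hlam : 0 < lam) :
    lam * tvNorm ws ≤ sIntR ws (etaF (alf M Kc yr ws)) := by
  set η := etaF (alf M Kc yr ws) with hη
  have hηc : Continuous η := etaF_cont _
  rw [← sub_nonneg]
  refine small_t _ ((1 / 2) * ∑ k : Fin Kc, ‖FF M ws k.1‖ ^ 2) fun t t0 t1 => ?_
  set s : NNReal := 1 - t with hs
  have hsr : (s : ℝ) = 1 - t := by rw [hs, NNReal.coe_sub t1]; rfl
  set μ : Measure Circle2pi := s • jp ws with hμ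
  set ν : Measure Circle2pi := s • jn ws with hν
  set w : SignedMeasure Circle2pi := μ.toSignedMeasure - ν.toSignedMeasure with hw
  have hμu : μ.real Set.univ = s * (jp ws).real Set.univ := by
    simp [hμ, measureReal_def]
  have hνu : ν.real Set.univ = s * (jn ws).real Set.univ := by
    simp [hν, measureReal_def]
  have hw0 : w Set.univ = 0 := by
    have : w Set.univ = μ.real Set.univ - ν.real Set.univ := by
      simp [hw, Measure.toSignedMeasure_apply]
    rw [univ_eq] at hzm
    rw [this, hμu, hνu, ← mul_sub, hzm, mul_zero]
  have htv : tvNorm w ≤ (1 - t) * tvNorm ws := by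
    have := tv_le w μ ν hw
    rw [hμu, hνu, hsr] at this
    rw [tv_eq ws]
    linarith
  have hL : sIntR w η = (1 - t) * sIntR ws η := by
    rw [sIntR_rep w μ ν hw η hηc, hμ, hν, integral_smul_nnreal_measure,
      integral_smul_nnreal_measure]
    unfold sIntR
    simp only [NNReal.smul_def, smul_eq_mul, hsr]
    ring
  have hF : ∀ n : ℤ, fCoeff w n = (1 - t) * fCoeff ws n := by
    intro n
    have hc : Continuous (fun x : Circle2pi => (fourier (-n) x : ℂ)) := map_continuous _
    unfold fCoeff
    rw [sIntC_rep w μ ν hw _ hc, hμ, hν, integral_smul_nnreal_measure,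
      integral_smul_nnreal_measure]
    unfold sIntC
    simp only [NNReal.smul_def, Complex.real_smul, hsr]
    push_cast
    ring
  have hFF : ∀ k : ℕ, ‖FF M w k - FF M ws k‖ ^ 2 = (t:ℝ) ^ 2 * ‖FF M ws k‖ ^ 2 := by
    intro k
    have : FF M w k - FF M ws k = -(t : ℂ) * FF M ws k := by
      unfold FF
      rw [hF]; ring
    rw [this, norm_mul, mul_pow]
    congr 2
    simp
  have hJ := hstar w y0 hw0
  rw [J_expand M Kc y0 yr lam ws w y0, ← hη, hL, Finset.sum_congr rfl fun k _ => hFF k.1,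
    ← Finset.mul_sum] at hJ
  have := mul_le_mul_of_nonneg_left htv hlam.le
  nlinarith

end opt

lemma G_eq (w : SignedMeasure Circle2pi) (hw : w Set.univ = 0) (η : Circle2pi → ℝ)
    (hη : Continuous η) (lam c : ℝ) :
    lam * tvNorm w - sIntR w η =
      (∫ x, (lam - (η x - c)) ∂(jp w)) + ∫ x, (lam + (η x - c)) ∂(jn w) := by
  rw [univ_eq] at hw
  have i1 : ∀ (μ : Measure Circle2pi) [IsFiniteMeasure μ],
      ∫ x, (lam - (η x - c)) ∂μ = lam * μ.real Set.univ - (∫ x, η x ∂μ) + c * μ.real Set.univ := by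
    intro μ _
    have : ∀ x, lam - (η x - c) = (lam + c) - η x := fun x => by ring
    simp only [this]
    rw [integral_sub (integ _ continuous_const) (integ _ hη), integral_const, smul_eq_mul]
    ring
  have i2 : ∀ (μ : Measure Circle2pi) [IsFiniteMeasure μ],
      ∫ x, (lam + (η x - c)) ∂μ = lam * μ.real Set.univ + (∫ x, η x ∂μ) - c * μ.real Set.univ := by
    intro μ _
    have : ∀ x, lam + (η x - c) = (lam - c) + η x := fun x => by ring
    simp only [this]
    rw [integral_add (integ _ continuous_const) (integ _ hη), integral_const, smul_eq_mul]
    ring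
  rw [i1, i2, tv_eq]
  unfold sIntR
  have : (jp w).real Set.univ = (jn w).real Set.univ := by linarith
  rw [this]
  ring

lemma weak_conc (u : ℕ → SignedMeasure Circle2pi) (C : ℝ)
    (hC : ∀ᶠ n in atTop, tvNorm (u n) ≤ C)
    (hp hm : Circle2pi → ℝ) (hpc : Continuous hp) (hmc : Continuous hm)
    (hp0 : ∀ x, 0 ≤ hp x) (hm0 : ∀ x, 0 ≤ hm x)
    (ψ : Circle2pi → ℂ) (hψ : Continuous ψ) (hz : ∀ x, hp x = 0 ∨ hm x = 0 → ψ x = 0)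
    (hlim : Tendsto (fun n => (∫ x, hp x ∂(jp (u n))) + ∫ x, hm x ∂(jn (u n))) atTop (nhds 0)) :
    Tendsto (fun n => sIntC (u n) ψ) atTop (nhds 0) := by
  have n1 : ∀ n, 0 ≤ ∫ x, hp x ∂(jp (u n)) := fun n => integral_nonneg hp0
  have n2 : ∀ n, 0 ≤ ∫ x, hm x ∂(jn (u n)) := fun n => integral_nonneg hm0
  have l1 : Tendsto (fun n => ∫ x, hp x ∂(jp (u n))) atTop (nhds 0) :=
    squeeze_zero n1 (fun n => by linarith [n2 n]) hlim
  have l2 : Tendsto (fun n => ∫ x, hm x ∂(jn (u n))) atTop (nhds 0) :=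
    squeeze_zero n2 (fun n => by linarith [n1 n]) hlim
  have c1 := conc (fun n => jp (u n)) C
    (hC.mono fun n h => by
      rw [tv_eq] at h
      have : 0 ≤ (jn (u n)).real Set.univ := measureReal_nonneg
      change (jp (u n)).real Set.univ ≤ C
      linarith)
    (fun x => ‖ψ x‖) hp hψ.norm hpc (fun x => norm_nonneg _) hp0
    (fun x h => by simp [hz x (Or.inl h)]) l1
  have c2 := conc (fun n => jn (u n)) C
    (hC.mono fun n h => by
      rw [tv_eq] at h
      have : 0 ≤ (jp (u n)).real Set.univ := measureReal_nonneg
      change (jn (u n)).real Set.univ ≤ C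
      linarith)
    (fun x => ‖ψ x‖) hm hψ.norm hmc (fun x => norm_nonneg _) hm0
    (fun x h => by simp [hz x (Or.inr h)]) l2
  have c3 := c1.add c2
  rw [add_zero] at c3
  exact squeeze_zero_norm (fun n => sIntC_bound (u n) ψ) c3

lemma tv_nonneg (w : SignedMeasure Circle2pi) : 0 ≤ tvNorm w := ENNReal.toReal_nonneg

/-- The minimizers `(w_P, a_P)` of the grid-discretized quadratic
problems converge to the unique minimizer `(w*, a*)` of the continuous problem: `w_P → w*`
in the weak* sense against continuous test functions, `a_P → a*`, and consequently the
reconstructions `g_M ⊛ w_P + a_P` converge pointwise to `g_M ⊛ w* + a*`. -/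
theorem stmt9 (M Kc : ℕ) (hM : 2 ≤ M) (lam : ℝ) (hlam : 0 < lam)
    (y0 : ℝ) (yr : Fin Kc → ℂ)
    (wstar : SignedMeasure Circle2pi) (astar : ℝ)
    (hzm : wstar Set.univ = 0)
    (hstar : ∀ (w : SignedMeasure Circle2pi) (a : ℝ), w Set.univ = 0 →
      quadJ M Kc y0 yr lam wstar astar ≤ quadJ M Kc y0 yr lam w a)
    (wP : ℕ → SignedMeasure Circle2pi) (aP : ℕ → ℝ)
    (hgrid : ∀ P : ℕ, 1 ≤ P → IsGridMeasure P (wP P))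
    (hPmin : ∀ P : ℕ, 1 ≤ P → ∀ (w : SignedMeasure Circle2pi) (a : ℝ), IsGridMeasure P w →
      quadJ M Kc y0 yr lam (wP P) (aP P) ≤ quadJ M Kc y0 yr lam w a) :
    (∀ φ : Circle2pi → ℝ, Continuous φ →
      Tendsto (fun P : ℕ => sIntR (wP P) φ) atTop (nhds (sIntR wstar φ))) ∧
    Tendsto aP atTop (nhds astar) ∧
    ∀ x : Circle2pi,
      Tendsto (fun P : ℕ => greenConv M (wP P) x + aP P) atTop
        (nhds (greenConv M wstar x + astar)) := by
  have ha : astar = y0 := by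
    have h := hstar wstar y0 hzm
    rw [J_expand M Kc y0 yr lam wstar wstar astar] at h
    simp only [sub_self, norm_zero] at h
    have h2 : (y0 - astar) ^ 2 ≤ 0 := by
      simp at h
      linarith
    have h3 : y0 - astar = 0 := by nlinarith [sq_nonneg (y0 - astar)]
    linarith
  rw [ha] at hstar ⊢
  clear ha
  set η := etaF (alf M Kc yr wstar) with hη
  have hηc : Continuous η := etaF_cont _
  have hosc : ∀ x y, η x - η y ≤ 2 * lam := opt_osc M Kc y0 yr lam wstar hzm hlam hstar
  have hlow := opt_lower M Kc y0 yr lam wstar hzm hstar hlam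
  rw [← hη] at hlow
  -- centre
  obtain ⟨c, hc1, hc2, E, hEcard, hE⟩ : ∃ c : ℝ, (∀ x, 0 ≤ lam - (η x - c)) ∧
      (∀ x, 0 ≤ lam + (η x - c)) ∧ ∃ E : Finset Circle2pi, E.card ≤ 2 * Kc ∧
        ∀ x, (lam - (η x - c) = 0 ∨ lam + (η x - c) = 0) → x ∈ E := by
    rcases eta_extr (alf M Kc yr wstar) with hconst | ⟨E, hE1, hE2⟩
    · have hc : ∀ x, η x = η 0 := fun x => hconst x 0
      refine ⟨η 0, fun x => by rw [hc x]; linarith, fun x => by rw [hc x]; linarith, ∅, by simp,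
        fun x hx => ?_⟩
      rw [hc x] at hx
      rcases hx with hx | hx <;> linarith
    · obtain ⟨xA, -, hA⟩ := isCompact_univ.exists_isMaxOn (Set.univ_nonempty) hηc.continuousOn
      obtain ⟨xB, -, hB⟩ := isCompact_univ.exists_isMinOn (Set.univ_nonempty) hηc.continuousOn
      have hA' : ∀ x, η x ≤ η xA := fun x => hA (Set.mem_univ x)
      have hB' : ∀ x, η xB ≤ η x := fun x => hB (Set.mem_univ x)
      have hAB := hosc xA xB
      have k1 : ∀ x, 0 ≤ lam - (η x - (η xA + η xB) / 2) := fun x => by linarith [hA' x]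
      have k2 : ∀ x, 0 ≤ lam + (η x - (η xA + η xB) / 2) := fun x => by linarith [hB' x]
      refine ⟨(η xA + η xB) / 2, k1, k2, E, hE1, fun x hx => hE2 x ?_⟩
      rcases hx with hx | hx
      · left; intro y
        change η y ≤ η x
        linarith [k1 y]
      · right; intro y
        change η x ≤ η y
        linarith [k2 y]
  have hpc : Continuous (fun x => lam - (η x - c)) := by fun_prop
  have hmc : Continuous (fun x => lam + (η x - c)) := by fun_prop
  have hG : ∀ w : SignedMeasure Circle2pi, w Set.univ = 0 → 0 ≤ lam * tvNorm w - sIntR w η := by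
    intro w hw
    rw [G_eq w hw η hηc lam c]
    exact add_nonneg (integral_nonneg hc1) (integral_nonneg hc2)
  have hG0 : lam * tvNorm wstar - sIntR wstar η = 0 :=
    le_antisymm (by linarith) (hG wstar hzm)
  have hw0 : ∀ P, 1 ≤ P → wP P Set.univ = 0 := fun P hP => grid_zero P _ (hgrid P hP)
  -- convergence of the objective gap
  have hfc : ∀ n : ℤ, Tendsto (fun P => fCoeff (vgrid P wstar) n) atTop
      (nhds (fCoeff wstar n)) := fun n => vgrid_tendsto wstar _ (map_continuous _)
  have hFFv : ∀ k : ℕ, Tendsto (fun P => FF M (vgrid P wstar) k) atTop (nhds (FF M wstar k)) :=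
    fun k => (hfc _).div_const _
  have hetav : Tendsto (fun P => sIntR (vgrid P wstar) η) atTop (nhds (sIntR wstar η)) := by
    simp only [hη, sIntR_eta]
    exact tendsto_finsetSum _ fun k _ =>
      (Complex.continuous_re.tendsto _).comp ((hfc _).const_mul _)
  have hr : Tendsto (fun P => - (sIntR (vgrid P wstar) η - sIntR wstar η)
      + (1 / 2) * ∑ k : Fin Kc, ‖FF M (vgrid P wstar) k.1 - FF M wstar k.1‖ ^ 2) atTop
      (nhds 0) := by
    have h1 : Tendsto (fun P => ∑ k : Fin Kc, ‖FF M (vgrid P wstar) k.1 - FF M wstar k.1‖ ^ 2)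
        atTop (nhds (∑ k : Fin Kc, ‖FF M wstar k.1 - FF M wstar k.1‖ ^ 2)) :=
      tendsto_finsetSum _ fun k _ => (((hFFv k.1).sub_const _).norm.pow 2)
    have h2 := ((hetav.sub_const (sIntR wstar η)).neg).add (h1.const_mul (1 / 2))
    simpa using h2
  set gap : ℕ → ℝ := fun P => (1 / 2) * (y0 - aP P) ^ 2
    + (1 / 2) * ∑ k : Fin Kc, ‖FF M (wP P) k.1 - FF M wstar k.1‖ ^ 2
    + (lam * tvNorm (wP P) - sIntR (wP P) η) with hgap
  have hgle : ∀ P, 1 ≤ P → gap P ≤ - (sIntR (vgrid P wstar) η - sIntR wstar η)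
      + (1 / 2) * ∑ k : Fin Kc, ‖FF M (vgrid P wstar) k.1 - FF M wstar k.1‖ ^ 2 := by
    intro P hP
    have h := hPmin P hP (vgrid P wstar) y0 (vgrid_grid P hP wstar hzm)
    rw [J_expand M Kc y0 yr lam wstar (wP P) (aP P),
      J_expand M Kc y0 yr lam wstar (vgrid P wstar) y0, ← hη] at h
    have htv := mul_le_mul_of_nonneg_left (vgrid_tv P wstar) hlam.le
    rw [sub_self] at h
    simp only [hgap]
    linarith
  have s1 : ∀ P, 0 ≤ (1 / 2) * (y0 - aP P) ^ 2 := fun P => by positivity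
  have s2 : ∀ P, 0 ≤ (1 / 2) * ∑ k : Fin Kc, ‖FF M (wP P) k.1 - FF M wstar k.1‖ ^ 2 :=
    fun P => by positivity
  have s3 : ∀ P, 1 ≤ P → 0 ≤ lam * tvNorm (wP P) - sIntR (wP P) η :=
    fun P hP => hG _ (hw0 P hP)
  have hge1 : ∀ᶠ P : ℕ in atTop, 1 ≤ P := eventually_ge_atTop 1
  have hgap0 : Tendsto gap atTop (nhds 0) :=
    squeeze_zero' (hge1.mono fun P hP => add_nonneg (add_nonneg (s1 P) (s2 P)) (s3 P hP))
      (hge1.mono hgle) hr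
  have t1 : Tendsto (fun P => (1 / 2) * (y0 - aP P) ^ 2) atTop (nhds 0) :=
    squeeze_zero' (Eventually.of_forall s1)
      (hge1.mono fun P hP => by simp only [hgap]; linarith [s2 P, s3 P hP]) hgap0
  have t2 : Tendsto (fun P => (1 / 2) * ∑ k : Fin Kc, ‖FF M (wP P) k.1 - FF M wstar k.1‖ ^ 2)
      atTop (nhds 0) :=
    squeeze_zero' (Eventually.of_forall s2)
      (hge1.mono fun P hP => by simp only [hgap]; linarith [s1 P, s3 P hP]) hgap0
  have t3 : Tendsto (fun P => lam * tvNorm (wP P) - sIntR (wP P) η) atTop (nhds 0) :=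
    squeeze_zero' (hge1.mono s3)
      (hge1.mono fun P hP => by simp only [hgap]; linarith [s1 P, s2 P]) hgap0
  -- the scalars
  have hsq : ∀ f : ℕ → ℝ, Tendsto (fun P => (1 / 2) * (f P) ^ 2) atTop (nhds 0) →
      Tendsto f atTop (nhds 0) := by
    intro f hf
    have h1 := (hf.const_mul 2).sqrt
    simp only [mul_zero, Real.sqrt_zero] at h1
    rw [tendsto_zero_iff_abs_tendsto_zero]
    refine h1.congr fun P => ?_
    rw [show 2 * (1 / 2 * f P ^ 2) = f P ^ 2 by ring, Real.sqrt_sq_eq_abs]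
    rfl
  have haP : Tendsto aP atTop (nhds y0) := by
    have h := (hsq _ t1).const_sub y0
    simpa using h
  have hFFP : ∀ k : Fin Kc, Tendsto (fun P => FF M (wP P) k.1) atTop (nhds (FF M wstar k.1)) := by
    intro k
    rw [tendsto_iff_norm_sub_tendsto_zero]
    refine hsq _ (squeeze_zero (fun P => by positivity) (fun P => ?_) t2)
    have := Finset.single_le_sum (f := fun k : Fin Kc => ‖FF M (wP P) k.1 - FF M wstar k.1‖ ^ 2)
      (fun i _ => by positivity) (Finset.mem_univ k)
    linarith
  have hfP : ∀ k : Fin Kc, Tendsto (fun P => fCoeff (wP P) ((k.1 : ℤ) + 1)) atTop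
      (nhds (fCoeff wstar ((k.1 : ℤ) + 1))) := by
    intro k
    have h := (hFFP k).mul_const ((Complex.I * ((k.1 + 1 : ℕ) : ℂ)) ^ M)
    unfold FF at h
    simp only [div_mul_cancel₀ _ (den_ne M k.1)] at h
    exact h
  have hfn : ∀ n : ℤ, |n| ≤ Kc → Tendsto (fun P => fCoeff (wP P) n) atTop
      (nhds (fCoeff wstar n)) := by
    intro n hn
    rw [abs_le] at hn
    rcases lt_trichotomy n 0 with h | h | h
    · have h1 := hfP ⟨(-n - 1).toNat, by omega⟩
      have e : (((-n - 1).toNat : ℕ) : ℤ) + 1 = -n := by omega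
      simp only [e, fCoeff_neg] at h1
      have h2 := (Complex.continuous_conj.tendsto _).comp h1
      simp only [Function.comp_def, Complex.conj_conj] at h2
      exact h2
    · subst h
      rw [fCoeff_zero wstar hzm]
      exact tendsto_const_nhds.congr' (hge1.mono fun P hP => (fCoeff_zero _ (hw0 P hP)).symm)
    · have h1 := hfP ⟨(n - 1).toNat, by omega⟩
      have e : (((n - 1).toNat : ℕ) : ℤ) + 1 = n := by omega
      simp only [e] at h1
      exact h1
  -- boundedness of the total variation
  obtain ⟨C, hC⟩ : ∃ C : ℝ, ∀ᶠ P in atTop, tvNorm (wP P) ≤ C := by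
    refine ⟨(quadJ M Kc y0 yr lam wstar y0 + 1) / lam, ?_⟩
    filter_upwards [hgap0.eventually (gt_mem_nhds (zero_lt_one)), hge1] with P hP1 hP
    rw [le_div_iff₀ hlam]
    have hJ := J_expand M Kc y0 yr lam wstar (wP P) (aP P)
    rw [← hη] at hJ
    have h2 : tvNorm (wP P) * lam ≤ quadJ M Kc y0 yr lam (wP P) (aP P) := by
      unfold quadJ
      rw [mul_comm]
      have : 0 ≤ (1 / 2) * ((y0 - aP P) ^ 2 + ∑ k : Fin Kc, ‖yr k - fCoeff (wP P) ((k.1 : ℤ) + 1) /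
        (Complex.I * ((k.1 + 1 : ℕ) : ℂ)) ^ M‖ ^ 2) := by positivity
      linarith
    simp only [hgap] at hP1
    linarith
  have hmain : ∀ φ : Circle2pi → ℝ, Continuous φ →
      Tendsto (fun P : ℕ => sIntR (wP P) φ) atTop (nhds (sIntR wstar φ)) := by
    intro φ hφ
    obtain ⟨b, hb⟩ := interp Kc E hEcard (fun x => (φ x : ℂ))
    set q : Circle2pi → ℂ := fun x =>
      ∑ j ∈ Finset.range (2 * Kc + 1), b j * fourier (-((Kc : ℤ) - j)) x with hq
    have hqj : ∀ j : ℕ, Continuous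
        (fun x : Circle2pi => b j * fourier (-((Kc : ℤ) - j)) x) := fun j =>
      continuous_const.mul (map_continuous _)
    have hqc : Continuous q := continuous_finsetSum _ fun j _ => hqj j
    have hφc : Continuous (fun x => (φ x : ℂ)) := Complex.continuous_ofReal.comp hφ
    have hqint : ∀ w, sIntC w q =
        ∑ j ∈ Finset.range (2 * Kc + 1), b j * fCoeff w ((Kc : ℤ) - j) := by
      intro w
      rw [hq, sIntC_sum _ _ _ hqj]
      refine Finset.sum_congr rfl fun j _ => ?_
      rw [sIntC_smul]
      rfl
    have hqlim : Tendsto (fun P => sIntC (wP P) q) atTop (nhds (sIntC wstar q)) := by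
      simp only [hqint]
      refine tendsto_finsetSum _ fun j hj => (hfn _ ?_).const_mul _
      rw [Finset.mem_range] at hj
      rw [abs_le]
      omega
    have hψc : Continuous (fun x => (φ x : ℂ) - q x) := hφc.sub hqc
    have hψz : ∀ x, lam - (η x - c) = 0 ∨ lam + (η x - c) = 0 → (φ x : ℂ) - q x = 0 := by
      intro x hx
      rw [sub_eq_zero]
      exact (hb x (hE x hx)).symm
    have hψ1 := weak_conc wP C hC _ _ hpc hmc hc1 hc2 _ hψc hψz
      (t3.congr' (hge1.mono fun P hP => G_eq _ (hw0 P hP) η hηc lam c))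
    have hψ2 := weak_conc (fun _ => wstar) (tvNorm wstar) (Eventually.of_forall fun _ => le_rfl)
      _ _ hpc hmc hc1 hc2 _ hψc hψz (by
        rw [← G_eq wstar hzm η hηc lam c, hG0]
        exact tendsto_const_nhds)
    have hψ3 := tendsto_nhds_unique hψ2 tendsto_const_nhds
    have hsplit : ∀ w, ((sIntR w φ : ℝ) : ℂ) = sIntC w (fun x => (φ x : ℂ) - q x) + sIntC w q := by
      intro w
      rw [ofReal_sIntR, ← sIntC_add w _ _ hψc hqc]
      simp
    have hlim := hψ1.add hqlim
    rw [hψ3, ← hsplit] at hlim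
    simp only [← hsplit] at hlim
    have := (Complex.continuous_re.tendsto _).comp hlim
    simpa [Function.comp_def] using this
  refine ⟨hmain, haP, fun x => ?_⟩
  refine Tendsto.add (hmain _ ?_) haP
  exact (tendsto_green M hM).comp (continuous_const.sub continuous_id)
end

section
/- Let M ≥ 2 and P ≥ 1 be integers. Then the real linear span of the P shifted periodic B-splines {β_{M,P}(· − 2πp/P) : p = 0, 1, …, P−1} equals the set of all functions f : 𝕋 → ℝ of the form f(x) = c + Σ_{p=0}^{P−1} a_p · g_M(x − 2πp/P) with c ∈ ℝ and a ∈ ℝ^P satisfying Σ_{p=0}^{P−1} a_p = 0. That is, the periodic B-spline is a generator of the P-dimensional space of uniform periodic D^M-splines with knots on the grid {2πp/P : 0 ≤ p ≤ P−1}. -/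
open MeasureTheory Filter
open scoped ENNReal Real

noncomputable section

/-- Fourier coefficients of the periodic B-spline: `β̂[0] = 1/P` and
`β̂[k] = P^{M-1}((1-e^{-2πik/P})/(2πik))^M` for `k ≠ 0`. -/
noncomputable def bsplineCoeff (M P : ℕ) (k : ℤ) : ℂ :=
  if k = 0 then 1 / (P : ℂ)
  else (P : ℂ) ^ (M - 1) *
    ((1 - Complex.exp (-(2 * Real.pi * Complex.I * (k : ℂ)) / (P : ℂ))) /
      (2 * Real.pi * Complex.I * (k : ℂ))) ^ M

/-- The periodic B-spline `β_{M,P}(x) = Σ_k β̂[k] e^{ikx}` (real-valued). -/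
noncomputable def bspline (M P : ℕ) (x : Circle2pi) : ℝ :=
  (∑' k : ℤ, bsplineCoeff M P k * fourier k x).re

end


/-- Backward difference with step `h`. -/
noncomputable def bdiff {E : Type*} [AddCommGroup E] (h : Circle2pi) (f : Circle2pi → E) :
    Circle2pi → E :=
  fun x => f x - f (x - h)

/-- Step `2π/P`. -/
noncomputable def gstep (P : ℕ) : Circle2pi := ((2 * Real.pi / (P : ℝ) : ℝ) : Circle2pi)

/-- Terms of the Fourier series of the `n`-th difference of the Green's function. -/
noncomputable def gterm (M P n : ℕ) (x : Circle2pi) (k : ℤ) : ℂ :=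
  if k = 0 then 0 else
    (1 - Complex.exp (-(2 * Real.pi * Complex.I * (k : ℂ)) / (P : ℂ))) ^ n *
      (fourier k x / (Complex.I * (k : ℂ)) ^ M)

lemma fourier_sub_gstep (P : ℕ) (k : ℤ) (x : Circle2pi) :
    (fourier k (x - gstep P) : ℂ) =
      Complex.exp (-(2 * Real.pi * Complex.I * (k : ℂ)) / (P : ℂ)) * fourier k x := by
  induction x using QuotientAddGroup.induction_on with
  | H y =>
    have h1 : ((y : Circle2pi) - gstep P) = ((y - 2 * Real.pi / (P : ℝ) : ℝ) : Circle2pi) := by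
      simp [gstep]
    change (fourier k ((y : Circle2pi) - gstep P) : ℂ) = _ * fourier k (y : Circle2pi)
    rw [h1, fourier_coe_apply, fourier_coe_apply, ← Complex.exp_add]
    congr 1
    have hpi : (Real.pi : ℂ) ≠ 0 := by exact_mod_cast Real.pi_ne_zero
    push_cast
    field_simp
    ring

lemma gterm_succ (M P n : ℕ) (x : Circle2pi) (k : ℤ) :
    gterm M P (n + 1) x k = gterm M P n x k - gterm M P n (x - gstep P) k := by
  unfold gterm
  split_ifs
  · simp
  · rw [fourier_sub_gstep]; ring

lemma gterm_summable (M P : ℕ) (hM : 2 ≤ M) (x : Circle2pi) : Summable (gterm M P 0 x) := by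
  have h := (Real.summable_one_div_int_pow (p := M)).2 (by omega)
  refine Summable.of_norm_bounded h.abs ?_
  intro k
  unfold gterm
  split_ifs
  · simp
  · simp [fourier_apply, Circle.norm_coe]

lemma hasSum_bdiff (M P : ℕ) (hM : 2 ≤ M) (n : ℕ) : ∀ x : Circle2pi,
    HasSum (gterm M P n x) ((bdiff (gstep P))^[n] (greenC M) x) := by
  induction n with
  | zero =>
    intro x
    have h := (gterm_summable M P hM x).hasSum
    convert h using 1
    simp [greenC, gterm]
  | succ n ih =>
    intro x
    rw [Function.iterate_succ_apply']
    have h := (ih x).sub (ih (x - gstep P))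
    refine HasSum.congr_fun h (fun k => gterm_succ M P n x k)

lemma bdiff_re (M : ℕ) (h : Circle2pi) (n : ℕ) : ∀ x : Circle2pi,
    ((bdiff h)^[n] (greenC M) x).re = (bdiff h)^[n] (greenR M) x := by
  induction n with
  | zero => intro x; rfl
  | succ n ih =>
    intro x
    rw [Function.iterate_succ_apply', Function.iterate_succ_apply']
    simp [bdiff, ih]

/-- The normalising constant. -/
noncomputable def kcst (M P : ℕ) : ℝ := (P : ℝ) ^ (M - 1) / (2 * Real.pi) ^ M

lemma bspline_eq (M P : ℕ) (hM : 2 ≤ M) (x : Circle2pi) :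
    bspline M P x = 1 / (P : ℝ) + kcst M P * (bdiff (gstep P))^[M] (greenR M) x := by
  have h1 := ((hasSum_bdiff M P hM M x).mul_left (kcst M P : ℂ))
  have h2 : HasSum (fun k : ℤ => if k = 0 then 1 / (P : ℂ) else 0) (1 / (P : ℂ)) :=
    hasSum_ite_eq 0 _
  have h3 := h2.add h1
  have h4 : (fun k : ℤ => bsplineCoeff M P k * fourier k x) =
      fun k : ℤ => (if k = 0 then 1 / (P : ℂ) else 0) + (kcst M P : ℂ) * gterm M P M x k := by
    funext k
    unfold bsplineCoeff gterm kcst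
    split_ifs with hk
    · simp [hk]
    · have hpi : (Real.pi : ℂ) ≠ 0 := by exact_mod_cast Real.pi_ne_zero
      push_cast
      rw [show (2 * (Real.pi : ℂ) * Complex.I * (k : ℂ)) =
        (2 * (Real.pi : ℂ)) * (Complex.I * (k : ℂ)) by ring, div_pow, mul_pow (2 * (Real.pi : ℂ))]
      ring
  unfold bspline
  rw [h4, h3.tsum_eq, ← bdiff_re, Complex.add_re, Complex.re_ofReal_mul]
  congr 1
  rw [← Complex.ofReal_re (1 / (P : ℝ))]
  push_cast
  rfl

/-- Cyclic difference of coefficients. -/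
noncomputable def cdiff (n : ℕ) : (Fin (n + 1) → ℝ) →ₗ[ℝ] (Fin (n + 1) → ℝ) where
  toFun c := fun p => c p - c (p - 1)
  map_add' a b := by funext p; simp; ring
  map_smul' a b := by funext p; simp; ring

lemma sum_cdiff (n : ℕ) (c : Fin (n + 1) → ℝ) : ∑ p, cdiff n c p = 0 := by
  have : ∑ p : Fin (n + 1), c (p - 1) = ∑ p, c p :=
    Equiv.sum_comp (Equiv.subRight (1 : Fin (n + 1))) c
  simp [cdiff, this]

lemma gridPt_succ (n : ℕ) (p : Fin (n + 1)) :
    gridPt (n + 1) (p + 1) = gridPt (n + 1) p + gstep (n + 1) := by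
  have hn : ((n : ℝ) + 1) ≠ 0 := by positivity
  unfold gridPt gstep
  rw [← AddCircle.coe_add]
  by_cases hp : p = Fin.last n
  · subst hp
    have : (2 * Real.pi * ((Fin.last n).1 : ℝ) / ((n + 1 : ℕ) : ℝ) +
        2 * Real.pi / ((n + 1 : ℕ) : ℝ)) = 2 * Real.pi := by
      push_cast [Fin.val_last]; field_simp
    rw [this, AddCircle.coe_period, Fin.last_add_one]
    simp
  · rw [Fin.val_add_one_of_lt (Fin.lt_last_iff_ne_last.2 hp)]
    congr 1
    push_cast; ring

lemma sum_bdiff (n : ℕ) (c : Fin (n + 1) → ℝ) (g : Circle2pi → ℝ) (x : Circle2pi) :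
    ∑ p, c p * bdiff (gstep (n + 1)) g (x - gridPt (n + 1) p) =
      ∑ p, cdiff n c p * g (x - gridPt (n + 1) p) := by
  have h : ∑ p : Fin (n + 1), c (p - 1) * g (x - gridPt (n + 1) p) =
      ∑ p, c p * g (x - gridPt (n + 1) p - gstep (n + 1)) := by
    rw [← Equiv.sum_comp (Equiv.addRight (1 : Fin (n + 1)))]
    refine Finset.sum_congr rfl fun p _ => ?_
    simp [gridPt_succ, sub_sub]
  simp only [bdiff, cdiff, LinearMap.coe_mk, AddHom.coe_mk, mul_sub, sub_mul,
    Finset.sum_sub_distrib, h]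

lemma sum_bdiff_iter (n m : ℕ) (g : Circle2pi → ℝ) (x : Circle2pi) : ∀ c : Fin (n + 1) → ℝ,
    ∑ p, c p * (bdiff (gstep (n + 1)))^[m] g (x - gridPt (n + 1) p) =
      ∑ p, (cdiff n)^[m] c p * g (x - gridPt (n + 1) p) := by
  induction m with
  | zero => intro c; rfl
  | succ m ih =>
    intro c
    rw [Function.iterate_succ_apply', sum_bdiff, ih, ← Function.iterate_succ_apply]

lemma cdiff_const (n : ℕ) (c : Fin (n + 1) → ℝ) (h : cdiff n c = 0) (p : Fin (n + 1)) :
    c p = c 0 := by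
  induction p using Fin.induction with
  | zero => rfl
  | succ i ih =>
    have := congrFun h i.succ
    have h2 : i.succ - 1 = i.castSucc := by
      rw [sub_eq_iff_eq_add, Fin.coeSucc_eq_succ]
    simp only [cdiff, LinearMap.coe_mk, AddHom.coe_mk, h2, Pi.zero_apply] at this
    linarith

/-- Sum-zero coefficients. -/
noncomputable def sumZero (n : ℕ) : Submodule ℝ (Fin (n + 1) → ℝ) where
  carrier := {c | ∑ p, c p = 0}
  add_mem' {a b} ha hb := by
    simp only [Set.mem_ofPred_eq] at *
    simp [Finset.sum_add_distrib, ha, hb]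
  zero_mem' := by simp
  smul_mem' r a ha := by
    simp only [Set.mem_ofPred_eq] at *
    simp [← Finset.mul_sum, ha]

lemma cdiff_surj (n : ℕ) (a : Fin (n + 1) → ℝ) (ha : ∑ p, a p = 0) :
    ∃ c : Fin (n + 1) → ℝ, ∑ p, c p = 0 ∧ cdiff n c = a := by
  let L : sumZero n →ₗ[ℝ] sumZero n :=
    (cdiff n).restrict (p := sumZero n) (q := sumZero n) (fun c _ => sum_cdiff n c)
  have hinj : Function.Injective L := by
    rw [injective_iff_map_eq_zero]
    rintro ⟨c, hc⟩ h
    have h0 : cdiff n c = 0 := congrArg Subtype.val h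
    have h1 := cdiff_const n c h0
    have hc' : ∑ p, c p = 0 := hc
    have h2 : c 0 = 0 := by
      rw [Finset.sum_congr rfl (fun p _ => h1 p)] at hc'
      simp only [Finset.sum_const, Finset.card_univ, Fintype.card_fin, nsmul_eq_mul] at hc'
      have hn : ((n + 1 : ℕ) : ℝ) ≠ 0 := by positivity
      exact (mul_eq_zero.1 hc').resolve_left hn
    apply Subtype.ext
    funext p
    simp [h1 p, h2]
  obtain ⟨⟨c, hc⟩, h⟩ := (LinearMap.injective_iff_surjective.1 hinj) ⟨a, ha⟩
  exact ⟨c, hc, congrArg Subtype.val h⟩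

lemma cdiff_iter_surj (n m : ℕ) : ∀ (a : Fin (n + 1) → ℝ), ∑ p, a p = 0 →
    ∃ c : Fin (n + 1) → ℝ, ∑ p, c p = 0 ∧ (cdiff n)^[m] c = a := by
  induction m with
  | zero => intro a ha; exact ⟨a, ha, rfl⟩
  | succ m ih =>
    intro a ha
    obtain ⟨b, hb, rfl⟩ := ih a ha
    obtain ⟨c, hc, rfl⟩ := cdiff_surj n b hb
    exact ⟨c, hc, rfl⟩

lemma sum_bspline (M n : ℕ) (hM : 2 ≤ M) (c : Fin (n + 1) → ℝ) (x : Circle2pi) :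
    ∑ p, c p * bspline M (n + 1) (x - gridPt (n + 1) p) =
      (∑ p, c p) / ((n + 1 : ℕ) : ℝ) +
        ∑ p, (kcst M (n + 1) * (cdiff n)^[M] c p) * greenR M (x - gridPt (n + 1) p) := by
  simp only [bspline_eq M (n + 1) hM, mul_add, Finset.sum_add_distrib, mul_assoc,
    ← Finset.mul_sum, ← sum_bdiff_iter]
  rw [← Finset.sum_mul, Finset.mul_sum]
  congr 1
  · ring
  · exact Finset.sum_congr rfl fun p _ => by ring

/-- The real linear span of the `P` shifted periodic B-splines
`β_{M,P}(· - 2πp/P)` equals the set of uniform periodic `D^M`-splines, i.e. functions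
`x ↦ c + Σ_p a_p g_M(x - 2πp/P)` with `Σ_p a_p = 0`. -/
theorem stmt10 (M P : ℕ) (hM : 2 ≤ M) (hP : 1 ≤ P) :
    {f : Circle2pi → ℝ | ∃ c : Fin P → ℝ,
        ∀ x, f x = ∑ p, c p * bspline M P (x - gridPt P p)} =
      {f : Circle2pi → ℝ | ∃ (cst : ℝ) (a : Fin P → ℝ), (∑ p, a p) = 0 ∧
        ∀ x, f x = cst + ∑ p, a p * greenR M (x - gridPt P p)} := by
  obtain ⟨n, rfl⟩ : ∃ n, P = n + 1 := ⟨P - 1, by omega⟩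
  have hn : ((n + 1 : ℕ) : ℝ) ≠ 0 := by positivity
  have hk : kcst M (n + 1) ≠ 0 := by unfold kcst; positivity
  have hz : ∀ c : Fin (n + 1) → ℝ, ∑ p, (cdiff n)^[M] c p = 0 := by
    intro c
    obtain ⟨m, rfl⟩ : ∃ m, M = m + 1 := ⟨M - 1, by omega⟩
    rw [Function.iterate_succ_apply']
    exact sum_cdiff n _
  ext f
  constructor
  · rintro ⟨c, hc⟩
    refine ⟨(∑ p, c p) / ((n + 1 : ℕ) : ℝ), fun p => kcst M (n + 1) * (cdiff n)^[M] c p, ?_, ?_⟩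
    · rw [← Finset.mul_sum, hz, mul_zero]
    · intro x
      rw [hc x, sum_bspline M n hM]
  · rintro ⟨r, a, ha, hf⟩
    obtain ⟨b, hb, hba⟩ := cdiff_iter_surj n M (fun p => (kcst M (n + 1))⁻¹ * a p)
      (by rw [← Finset.mul_sum, ha, mul_zero])
    have hshift : ∀ m : ℕ, 1 ≤ m → (cdiff n)^[m] (fun p => b p + r) = (cdiff n)^[m] b := by
      intro m hm
      obtain ⟨l, rfl⟩ : ∃ l, m = l + 1 := ⟨m - 1, by omega⟩
      rw [Function.iterate_succ_apply, Function.iterate_succ_apply]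
      congr 1
      funext p
      simp [cdiff]
    refine ⟨fun p => b p + r, fun x => ?_⟩
    rw [sum_bspline M n hM, hf x, hshift M (by omega), hba]
    congr 1
    · rw [Finset.sum_add_distrib, hb]
      simp only [Finset.sum_const, Finset.card_univ, Fintype.card_fin, nsmul_eq_mul]
      field_simp
      ring
    · exact Finset.sum_congr rfl fun p _ => by field_simp
end

section
/- Let M ≥ 2 and P ≥ 1 be integers. Then the P functions β_{M,P}(· − 2πp/P), for p = 0, 1, …, P−1, are linearly independent over ℝ: if c ∈ ℝ^P satisfies Σ_{p=0}^{P−1} c_p · β_{M,P}(x − 2πp/P) = 0 for all x ∈ 𝕋, then c = 0. Consequently, the space of uniform periodic D^M-splines with knots on the grid {2πp/P} is P-dimensional. -/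
open MeasureTheory Filter
open scoped ENNReal Real

lemma aux_zero (a : ℤ → ℂ) (ha : Summable fun k => ‖a k‖)
    (h : ∀ x : Circle2pi, ∑' k, a k * fourier k x = 0) (k : ℤ) : a k = 0 := by
  have hs : Summable fun k => a k • (fourier k : C(Circle2pi, ℂ)) := by
    apply Summable.of_norm
    simpa [norm_smul, fourier_norm] using ha
  have h0 : HasSum (fun k => a k • (fourier k : C(Circle2pi, ℂ))) 0 := by
    have := hs.hasSum
    convert this using 1
    ext x
    have h1 := (ContinuousMap.hasSum_apply this x).tsum_eq
    rw [← h1]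
    simpa using (h x).symm
  have h2 := (ContinuousMap.toLp (E := ℂ) 2 (AddCircle.haarAddCircle (T := 2 * Real.pi)) ℂ).hasSum h0
  have h3 := (innerSL ℂ (fourierLp (T := 2 * Real.pi) 2 k)).hasSum h2
  have h4 : HasSum (fun j => if j = k then a j else 0) (0 : ℂ) := by
    refine Eq.mp (congrArg₂ (fun f s => HasSum f s) ?_ ?_) h3 <;> symm
    · funext j
      have := (orthonormal_iff_ite.mp (orthonormal_fourier (T := 2 * Real.pi))) k j
      rw [map_smul, map_smul, innerSL_apply_apply]
      change _ = a j • inner ℂ (fourierLp 2 k) (fourierLp 2 j)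
      rw [this]
      by_cases hjk : j = k
      · simp [hjk]
      · simp [hjk, Ne.symm hjk]
    · rw [map_zero, map_zero]
  exact (hasSum_ite_eq k (a k)).unique (by convert h4 using 2 with j; split_ifs with hj <;> simp [hj])

lemma aux_norm_exp (P : ℕ) (k : ℤ) :
    ‖Complex.exp (-(2 * Real.pi * Complex.I * (k : ℂ)) / (P : ℂ))‖ = 1 := by
  have : (-(2 * Real.pi * Complex.I * (k : ℂ)) / (P : ℂ)) =
    ((-(2 * Real.pi * k / P) : ℝ) : ℂ) * Complex.I := by push_cast; ring
  rw [this, Complex.norm_exp_ofReal_mul_I]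

lemma aux_summable (M P : ℕ) (hM : 2 ≤ M) : Summable fun k => ‖bsplineCoeff M P k‖ := by
  have h1 : Summable fun k : ℤ => |(k : ℝ)| ^ (-(M : ℝ)) := by
    apply Real.summable_abs_int_rpow
    exact_mod_cast hM
  have h2 : Summable fun k : ℤ => (P : ℝ) ^ (M - 1) * |(k : ℝ)| ^ (-(M : ℝ)) + if k = 0 then ‖(1 / P : ℂ)‖ else 0 :=
    (h1.mul_left _).add (hasSum_ite_eq _ _).summable
  refine Summable.of_nonneg_of_le (fun _ => norm_nonneg _) (fun k => ?_) h2
  unfold bsplineCoeff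
  split_ifs with hk
  · have : 0 ≤ (P : ℝ) ^ (M - 1) * |(k : ℝ)| ^ (-(M : ℝ)) := by positivity
    linarith
  · rw [add_zero, norm_mul, norm_pow, norm_pow, norm_div, Complex.norm_natCast]
    have hk' : 0 < |(k : ℝ)| := by positivity
    have hk0 : ‖(2 * Real.pi * Complex.I * (k : ℂ))‖ = 2 * Real.pi * |(k : ℝ)| := by
      simp [abs_of_pos Real.pi_pos]
    rw [hk0, Real.rpow_neg hk'.le, Real.rpow_natCast, ← inv_pow]
    gcongr
    rw [div_le_iff₀ (by positivity)]
    have := norm_sub_le (1 : ℂ) (Complex.exp (-(2 * Real.pi * Complex.I * (k : ℂ)) / (P : ℂ)))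
    rw [aux_norm_exp, norm_one] at this
    have e : |(k : ℝ)|⁻¹ * (2 * Real.pi * |(k : ℝ)|) = 2 * Real.pi := by field_simp
    rw [e]
    linarith [Real.pi_gt_three]

lemma aux_conj (M P : ℕ) (k : ℤ) :
    (starRingEnd ℂ) (bsplineCoeff M P k) = bsplineCoeff M P (-k) := by
  unfold bsplineCoeff
  by_cases hk : k = 0
  · simp [hk]
  · rw [if_neg hk, if_neg (by simpa using hk)]
    simp only [map_mul, map_pow, map_div₀, map_sub, map_one, ← Complex.exp_conj, map_neg,
      Complex.conj_I, Complex.conj_ofReal, map_natCast, map_intCast, map_ofNat, Int.cast_neg]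
    ring_nf

lemma aux_summable_x (M P : ℕ) (hM : 2 ≤ M) (x : Circle2pi) :
    Summable fun k => bsplineCoeff M P k * fourier k x := by
  apply Summable.of_norm
  refine (aux_summable M P hM).congr fun k => ?_
  rw [norm_mul, fourier_apply, Circle.norm_coe, mul_one]

lemma aux_real (M P : ℕ) (x : Circle2pi) :
    (bspline M P x : ℂ) = ∑' k : ℤ, bsplineCoeff M P k * fourier k x := by
  unfold bspline
  apply Complex.conj_eq_iff_re.mp
  rw [Complex.conj_tsum, ← (Equiv.neg ℤ).tsum_eq]
  congr 1
  ext k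
  simp only [Equiv.neg_apply, map_mul, aux_conj, neg_neg]
  rw [← fourier_neg, neg_neg]

lemma aux_coeff_ne (M P : ℕ) (hP : 1 ≤ P) (k : Fin P) : bsplineCoeff M P (k.1 : ℤ) ≠ 0 := by
  have hP0 : (P : ℂ) ≠ 0 := by exact_mod_cast (by omega : P ≠ 0)
  unfold bsplineCoeff
  split_ifs with hk
  · simpa using hP0
  · have hk0 : k.1 ≠ 0 := by exact_mod_cast hk
    have hk1 : (((k.1 : ℤ)) : ℂ) ≠ 0 := by exact_mod_cast hk
    refine mul_ne_zero (pow_ne_zero _ hP0) (pow_ne_zero _ (div_ne_zero ?_ ?_))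
    · intro h
      have hz := Complex.isPrimitiveRoot_exp P (by omega)
      apply hz.pow_ne_one_of_pos_of_lt hk0 k.2
      rw [← Complex.exp_nat_mul]
      rw [← inv_inj, ← Complex.exp_neg, inv_one]
      refine Eq.trans ?_ (sub_eq_zero.mp h).symm
      congr 1
      push_cast
      ring
    · simp only [ne_eq, mul_eq_zero, not_or]
      refine ⟨⟨⟨two_ne_zero, ?_⟩, Complex.I_ne_zero⟩, hk1⟩
      exact_mod_cast Real.pi_ne_zero

lemma aux_fourier_grid (P : ℕ) (p : Fin P) (k : ℤ) :
    (fourier k (-gridPt P p) : ℂ) = ((Complex.exp (2 * Real.pi * Complex.I / P) ^ p.1)⁻¹) ^ k := by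
  unfold gridPt
  rw [← Complex.exp_nat_mul, ← Complex.exp_neg, ← Complex.exp_int_mul, ← AddCircle.coe_neg,
    fourier_coe_apply]
  congr 1
  have : (Real.pi : ℂ) ≠ 0 := by exact_mod_cast Real.pi_ne_zero
  push_cast
  field_simp

lemma aux_indep (M P : ℕ) (hM : 2 ≤ M) (hP : 1 ≤ P) (c : Fin P → ℝ)
    (h : ∀ x : Circle2pi, ∑ p, c p * bspline M P (x - gridPt P p) = 0) : c = 0 := by
  set f : Fin P → ℂ := fun p => (Complex.exp (2 * Real.pi * Complex.I / P) ^ p.1)⁻¹ with hf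
  have hinj : Function.Injective f := by
    intro p q hpq
    have hz := Complex.isPrimitiveRoot_exp P (by omega)
    exact Fin.ext (hz.pow_inj p.2 q.2 (inv_injective hpq))
  have hD : Summable fun k : ℤ => ‖bsplineCoeff M P k * ∑ p, (c p : ℂ) * f p ^ k‖ := by
    refine Summable.of_nonneg_of_le (fun _ => norm_nonneg _) (fun k => ?_)
      ((aux_summable M P hM).mul_right (∑ p, |c p|))
    rw [norm_mul]
    gcongr
    refine (norm_sum_le _ _).trans (Finset.sum_le_sum fun p _ => ?_)
    rw [norm_mul, ← aux_fourier_grid, fourier_apply, Circle.norm_coe, mul_one, Complex.norm_real,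
      Real.norm_eq_abs]
  have hz := aux_zero _ hD (by
    intro x
    have hx : ((∑ p, c p * bspline M P (x - gridPt P p) : ℝ) : ℂ) = 0 := by rw [h x]; simp
    rw [← hx]
    push_cast
    simp_rw [aux_real, ← tsum_mul_left]
    rw [← Summable.tsum_finsetSum (fun p _ => (aux_summable_x M P hM _).mul_left _)]
    congr 1
    ext k
    rw [Finset.mul_sum, Finset.sum_mul]
    refine Finset.sum_congr rfl fun p _ => ?_
    have e : (fourier k (x - gridPt P p) : ℂ) = fourier k x * f p ^ k := by
      rw [hf, ← aux_fourier_grid, sub_eq_add_neg]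
      simp [fourier_apply, smul_add, AddCircle.toCircle_add]
    rw [e]
    ring)
  have hv := Matrix.eq_zero_of_forall_pow_sum_mul_pow_eq_zero (f := f) (v := fun p => (c p : ℂ))
    hinj (fun i => by
      have := (mul_eq_zero.mp (hz (i.1 : ℤ))).resolve_left (aux_coeff_ne M P hP i)
      simpa using this)
  ext p
  have := congrFun hv p
  simpa using this


/-- The `P` shifted periodic B-splines `β_{M,P}(· - 2πp/P)` are
linearly independent over `ℝ`; consequently the space of uniform periodic `D^M`-splines
with knots on the grid, which they span, is `P`-dimensional. -/
theorem stmt11 (M P : ℕ) (hM : 2 ≤ M) (hP : 1 ≤ P) :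
    (∀ c : Fin P → ℝ,
      (∀ x : Circle2pi, ∑ p, c p * bspline M P (x - gridPt P p) = 0) → c = 0) ∧
    Module.finrank ℝ
      ↥(Submodule.span ℝ
        (Set.range fun p : Fin P => fun x : Circle2pi => bspline M P (x - gridPt P p))) = P := by
  refine ⟨fun c h => aux_indep M P hM hP c h, ?_⟩
  rw [finrank_span_eq_card, Fintype.card_fin]
  rw [Fintype.linearIndependent_iff]
  intro c hc p
  refine congrFun (aux_indep M P hM hP c fun x => ?_) p
  simpa using congrFun hc x
end
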